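/- arXiv:1806.07586 — 3 statements merged into one kernel-verified Lean document; each statement's English description precedes it below -/
import Mathlib

section
/- Suppose a ∈ A has degree 1 in G and its unique neighbor u also belongs to A. Then every solution to Disjoint A,B-paths on G contains the single-edge path au as one of its paths, and the map E′ ↦ E′∖{au} is a bijection between solutions of Disjoint A,B-paths on G and solutions of Disjoint A∖{a,u},B-paths on G − {a,u} that decreases the length by exactly ℓ(au). In particular, a solution on G exists if and only if one on G − {a,u} exists, and in that case ℓ_{A,B}(G) = ℓ(au) + ℓ_{A∖{a,u},B}(G−{a,u}) and the numbers of minimum-length solutions coincide. -/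
/-- `f` is a family of `(|A|+|B|)/2` pairwise vertex-disjoint simple paths of `G`,
each with both endpoints in `A` or both endpoints in `B`, such that every vertex of
`A ∪ B` is an endpoint of one of the paths, and `E'` is the union of their edge
sets.  This witnesses that `E'` is a solution to Disjoint `A`,`B`-paths. -/
def IsPathFamily {V : Type} [DecidableEq V] (G : SimpleGraph V) (A B : Finset V)
    (E' : Set (Sym2 V)) {k : ℕ} (f : Fin k → (u : V) × (v : V) × G.Walk u v) : Prop :=
  k = (A.card + B.card) / 2 ∧
  (∀ i, (f i).2.2.IsPath) ∧
  (∀ i, ((f i).1 ∈ A ∧ (f i).2.1 ∈ A) ∨ ((f i).1 ∈ B ∧ (f i).2.1 ∈ B)) ∧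
  (∀ i j, i ≠ j → ∀ x, x ∈ (f i).2.2.support → x ∉ (f j).2.2.support) ∧
  (∀ z, z ∈ A ∪ B → ∃ i, z = (f i).1 ∨ z = (f i).2.1) ∧
  E' = ⋃ i, {e | e ∈ (f i).2.2.edges}

/-- `E'` is a solution to Disjoint `A`,`B`-paths on `G`. -/
def IsSolution {V : Type} [DecidableEq V] (G : SimpleGraph V) (A B : Finset V)
    (E' : Set (Sym2 V)) : Prop :=
  ∃ (k : ℕ) (f : Fin k → (u : V) × (v : V) × G.Walk u v), IsPathFamily G A B E' f

/-- The length of an edge set: the sum of the lengths of its edges. -/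
noncomputable def lengthOf {V : Type} (ℓ : Sym2 V → ℕ) (E' : Set (Sym2 V)) : ℕ :=
  ∑ᶠ e ∈ E', ℓ e

/-- `ℓ_{A,B}`: the minimum length of a solution to Disjoint `A`,`B`-paths. -/
noncomputable def lAB {V : Type} [DecidableEq V] (G : SimpleGraph V) (A B : Finset V)
    (ℓ : Sym2 V → ℕ) : ℕ :=
  sInf {n | ∃ E', IsSolution G A B E' ∧ lengthOf ℓ E' = n}

/-- `S_{A,B}`: the number of minimum-length solutions to Disjoint `A`,`B`-paths. -/
noncomputable def nSol {V : Type} [DecidableEq V] (G : SimpleGraph V) (A B : Finset V)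
    (ℓ : Sym2 V → ℕ) : ℕ :=
  Set.ncard {E' | IsSolution G A B E' ∧ lengthOf ℓ E' = lAB G A B ℓ}

namespace SimpleGraph.Walk

variable {V : Type} {G : SimpleGraph V} {a u : V}

/-- A nontrivial walk starting at a leaf visits the neighbor of the leaf. -/
theorem mem_support_of_unique_adj (hnb : ∀ v, G.Adj a v → v = u) {x y : V}
    (w : G.Walk x y) (hx : x = a) (hxy : x ≠ y) : u ∈ w.support := by
  cases w with
  | nil => exact absurd rfl hxy
  | cons h p =>
    subst hx
    obtain rfl := hnb _ h
    simp

/-- A path from a leaf to its neighbor consists of a single edge. -/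
theorem IsPath.edges_eq_of_unique_adj (hnb : ∀ v, G.Adj a v → v = u) (hau : a ≠ u) {x y : V}
    {w : G.Walk x y} (hw : w.IsPath) (hx : x = a) (hy : y = u) : w.edges = [s(a, u)] := by
  cases w with
  | nil => exact absurd (hx.symm.trans hy) hau
  | cons h p =>
    subst hx
    obtain rfl := hnb _ h
    subst hy
    have hp := (cons_isPath_iff h p).1 hw
    rw [isPath_iff_nil, ← eq_nil_iff_nil] at hp
    simp [hp.1]

end SimpleGraph.Walk

section

variable {V : Type} [DecidableEq V] {G : SimpleGraph V} {A B : Finset V} {E' : Set (Sym2 V)}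

/-- The two endpoints of each path in a path family are distinct. -/
theorem IsPathFamily.fst_ne_snd {k : ℕ} {f : Fin k → (u : V) × (v : V) × G.Walk u v}
    (hf : IsPathFamily G A B E' f) (hdisj : Disjoint A B) (hA : Even A.card) (hB : Even B.card)
    (i : Fin k) : (f i).1 ≠ (f i).2.1 := by
  obtain ⟨hk, -, hend, -, hcov, -⟩ := hf
  intro h
  let e : Fin k × Bool → V := fun p => if p.2 then (f p.1).1 else (f p.1).2.1
  have hinj : Set.InjOn e (Finset.univ : Finset (Fin k × Bool)) := by
    refine Finset.injOn_of_surjOn_of_card_le (t := A ∪ B) e ?_ ?_ ?_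
    · rintro ⟨j, b⟩ -
      have := hend j
      cases b <;> simp [e] <;> tauto
    · intro z hz
      obtain ⟨j, hj | hj⟩ := hcov z hz
      · exact ⟨(j, true), by simp, by simp [e, hj]⟩
      · exact ⟨(j, false), by simp, by simp [e, hj]⟩
    · rw [Finset.card_union_of_disjoint hdisj]
      simp only [Finset.card_univ, Fintype.card_prod, Fintype.card_fin, Fintype.card_bool]
      have := Nat.even_add.2 (iff_of_true hA hB)
      rw [hk]
      obtain ⟨m, hm⟩ := this
      omega
  have := @hinj (i, true) (by simp) (i, false) (by simp) (by simpa [e] using h)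
  simp at this

/-- If a leaf and its neighbor are both terminals, some path of the family joins them. -/
theorem IsPathFamily.exists_leaf_path {k : ℕ} {f : Fin k → (u : V) × (v : V) × G.Walk u v}
    (hf : IsPathFamily G A B E' f) (hdisj : Disjoint A B) (hA : Even A.card) (hB : Even B.card)
    {a u : V} (ha : a ∈ A) (hu : u ∈ A) (hau : a ≠ u) (hnb : ∀ v, G.Adj a v → v = u) :
    ∃ i, (((f i).1 = a ∧ (f i).2.1 = u) ∨ ((f i).1 = u ∧ (f i).2.1 = a)) ∧
      {e | e ∈ (f i).2.2.edges} = {s(a, u)} := by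
  have hne := hf.fst_ne_snd hdisj hA hB
  obtain ⟨-, hpath, -, hvd, hcov, -⟩ := hf
  obtain ⟨i, hi⟩ := hcov a (Finset.mem_union_left _ ha)
  obtain ⟨j, hj⟩ := hcov u (Finset.mem_union_left _ hu)
  have hui : u ∈ (f i).2.2.support := by
    rcases hi with hi | hi
    · exact (f i).2.2.mem_support_of_unique_adj hnb hi.symm (hne i)
    · have := (f i).2.2.reverse.mem_support_of_unique_adj hnb hi.symm (hne i).symm
      simpa using this
  have huj : u ∈ (f j).2.2.support := by
    rcases hj with hj | hj
    · rw [hj]; exact SimpleGraph.Walk.start_mem_support _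
    · rw [hj]; exact SimpleGraph.Walk.end_mem_support _
  have hij : i = j := by
    by_contra h
    exact hvd i j h u hui huj
  subst hij
  refine ⟨i, ?_⟩
  rcases hi with hi | hi <;> rcases hj with hj | hj
  · exact absurd (hi.trans hj.symm) hau
  · refine ⟨Or.inl ⟨hi.symm, hj.symm⟩, ?_⟩
    rw [(hpath i).edges_eq_of_unique_adj hnb hau hi.symm hj.symm]
    simp
  · refine ⟨Or.inr ⟨hj.symm, hi.symm⟩, ?_⟩
    have := (hpath i).reverse.edges_eq_of_unique_adj hnb hau hi.symm hj.symm
    ext e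
    rw [Set.mem_ofPred_eq, ← List.mem_reverse, ← SimpleGraph.Walk.edges_reverse, this]
    simp
  · exact absurd (hi.trans hj.symm) hau

/-- Dropping the path joining `a` and `u` gives a solution on any graph that contains all edges
avoiding `a` and `u`. -/
theorem IsPathFamily.isSolution_diff {k : ℕ} {f : Fin k → (u : V) × (v : V) × G.Walk u v}
    (hf : IsPathFamily G A B E' f) {a u : V} (ha : a ∈ A) (hu : u ∈ A) (hau : a ≠ u)
    (hdisj : Disjoint A B) {H : SimpleGraph V}
    (hH : ∀ x y, G.Adj x y → x ≠ a → x ≠ u → y ≠ a → y ≠ u → H.Adj x y) (i : Fin k)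
    (hi : ((f i).1 = a ∧ (f i).2.1 = u) ∨ ((f i).1 = u ∧ (f i).2.1 = a))
    (hedge : {e | e ∈ (f i).2.2.edges} = {s(a, u)}) :
    IsSolution H ((A.erase a).erase u) B (E' \ {s(a, u)}) := by
  obtain ⟨hk, hpath, hend, hvd, hcov, hE⟩ := hf
  obtain ⟨n, rfl⟩ : ∃ n, k = n + 1 := ⟨k - 1, by have := i.pos; omega⟩
  have hfst : (f i).1 ∈ (f i).2.2.support := SimpleGraph.Walk.start_mem_support _
  have hsnd : (f i).2.1 ∈ (f i).2.2.support := SimpleGraph.Walk.end_mem_support _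
  have hai : a ∈ (f i).2.2.support := by
    rcases hi with ⟨h, -⟩ | ⟨-, h⟩
    · rwa [← h]
    · rwa [← h]
  have hui : u ∈ (f i).2.2.support := by
    rcases hi with ⟨-, h⟩ | ⟨h, -⟩
    · rwa [← h]
    · rwa [← h]
  have havoid : ∀ j, ∀ x ∈ (f (i.succAbove j)).2.2.support, x ≠ a ∧ x ≠ u := by
    intro j x hx
    constructor
    · rintro rfl
      exact hvd _ _ (Fin.succAbove_ne i j) _ hx hai
    · rintro rfl
      exact hvd _ _ (Fin.succAbove_ne i j) _ hx hui
  have htr : ∀ j, ∀ e ∈ (f (i.succAbove j)).2.2.edges, e ∈ H.edgeSet := by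
    intro j e he
    induction e with
    | h x y =>
      have hx := havoid j x (SimpleGraph.Walk.fst_mem_support_of_mem_edges _ he)
      have hy := havoid j y (SimpleGraph.Walk.snd_mem_support_of_mem_edges _ he)
      exact hH x y (SimpleGraph.Walk.adj_of_mem_edges _ he) hx.1 hx.2 hy.1 hy.2
  refine ⟨n, fun j => ⟨_, _, (f (i.succAbove j)).2.2.transfer H (htr j)⟩, ?_, ?_, ?_, ?_, ?_, ?_⟩
  · have hu' : u ∈ A.erase a := Finset.mem_erase.2 ⟨hau.symm, hu⟩
    have h1 := Finset.card_erase_add_one ha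
    have h2 := Finset.card_erase_add_one hu'
    omega
  · exact fun j => (hpath _).transfer _
  · intro j
    have h1 := havoid j _ (SimpleGraph.Walk.start_mem_support _)
    have h2 := havoid j _ (SimpleGraph.Walk.end_mem_support _)
    simpa [h1, h2] using hend (i.succAbove j)
  · intro j l hjl x hx
    simp only [SimpleGraph.Walk.support_transfer] at hx ⊢
    exact hvd _ _ (fun h => hjl (Fin.succAbove_right_injective h)) x hx
  · intro z hz
    have hz' : z ∈ A ∪ B := by
      simp only [Finset.mem_union, Finset.mem_erase] at hz ⊢
      tauto
    obtain ⟨l, hl⟩ := hcov z hz'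
    by_cases hli : l = i
    · subst hli
      exfalso
      have hzau : z = a ∨ z = u := by
        rcases hi with ⟨h₁, h₂⟩ | ⟨h₁, h₂⟩ <;> rcases hl with hl | hl <;> simp [hl, h₁, h₂]
      simp only [Finset.mem_union, Finset.mem_erase] at hz
      rcases hzau with rfl | rfl
      · have := Finset.disjoint_left.1 hdisj ha
        tauto
      · have := Finset.disjoint_left.1 hdisj hu
        tauto
    · obtain ⟨j, rfl⟩ := Fin.exists_succAbove_eq hli
      exact ⟨j, hl⟩
  · subst hE
    ext e
    simp only [SimpleGraph.Walk.edges_transfer, Set.mem_sdiff, Set.mem_iUnion, Set.mem_ofPred_eq,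
      Set.mem_singleton_iff]
    constructor
    · rintro ⟨⟨l, hl⟩, he⟩
      by_cases hli : l = i
      · subst hli
        exact absurd (hedge.subset hl) he
      · obtain ⟨j, rfl⟩ := Fin.exists_succAbove_eq hli
        exact ⟨j, hl⟩
    · rintro ⟨j, hj⟩
      refine ⟨⟨_, hj⟩, ?_⟩
      rintro rfl
      exact (havoid j a (SimpleGraph.Walk.fst_mem_support_of_mem_edges _ hj)).1 rfl

/-- Adding the edge `au` to a solution on a subgraph avoiding `a` and `u` gives a solution. -/
theorem IsSolution.insert_edge {H : SimpleGraph V} {a u : V} (ha : a ∈ A) (hu : u ∈ A)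
    (hadj : G.Adj a u) (hHG : H ≤ G) (hHa : ∀ v, ¬ H.Adj a v) (hHu : ∀ v, ¬ H.Adj u v)
    (hdisj : Disjoint A B)
    (hE : IsSolution H ((A.erase a).erase u) B E') :
    IsSolution G A B (insert s(a, u) E') := by
  obtain ⟨k, f, hk, hpath, hend, hvd, hcov, hE⟩ := hE
  have haB : a ∉ B := Finset.disjoint_left.1 hdisj ha
  have huB : u ∉ B := Finset.disjoint_left.1 hdisj hu
  have hisol : ∀ c : V, (∀ v, ¬ H.Adj c v) → c ∉ (A.erase a).erase u → c ∉ B →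
      ∀ j, c ∉ (f j).2.2.support := by
    intro c hc hcA hcB j hcj
    have hst : (f j).1 ≠ c := by
      rintro rfl
      rcases hend j with h | h
      · exact hcA h.1
      · exact hcB h.1
    have hadj : ∀ {x y : V} (w : H.Walk x y), c ∈ w.support → x = c := by
      intro x y w
      induction w with
      | nil => simp [eq_comm]
      | cons h p ih =>
        intro hmem
        rw [SimpleGraph.Walk.support_cons, List.mem_cons] at hmem
        rcases hmem with h' | h'
        · exact h'.symm
        · have := ih h'
          subst this
          exact absurd h.symm (hc _)
    exact hst (hadj _ hcj)
  have hia := hisol a hHa (by simp) haB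
  have hiu := hisol u hHu (by simp) huB
  have hnew : ∀ j x, x ∈ (f j).2.2.support → x ≠ a ∧ x ≠ u := fun j x hx =>
    ⟨fun h => hia j (h ▸ hx), fun h => hiu j (h ▸ hx)⟩
  let g : Fin (k + 1) → (x : V) × (y : V) × G.Walk x y :=
    Fin.cons ⟨a, u, hadj.toWalk⟩ fun j => ⟨_, _, (f j).2.2.mapLe hHG⟩
  have hsupp₀ : ∀ x, x ∈ (g 0).2.2.support → x = a ∨ x = u := fun x hx => by
    change x ∈ hadj.toWalk.support at hx
    simpa using hx
  have hsupp : ∀ j : Fin k, (g j.succ).2.2.support = (f j).2.2.support := fun j => by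
    change ((f j).2.2.mapLe hHG).support = _
    simp
  have hedges₀ : (g 0).2.2.edges = [s(a, u)] := by
    change hadj.toWalk.edges = _
    simp
  have hedges : ∀ j : Fin k, (g j.succ).2.2.edges = (f j).2.2.edges := fun j => by
    change ((f j).2.2.mapLe hHG).edges = _
    simp
  refine ⟨k + 1, g, ?_, ?_, ?_, ?_, ?_, ?_⟩
  · have hu' : u ∈ A.erase a := Finset.mem_erase.2 ⟨hadj.ne.symm, hu⟩
    have h1 := Finset.card_erase_add_one ha
    have h2 := Finset.card_erase_add_one hu'
    omega
  · intro i
    cases i using Fin.cases with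
    | zero => exact SimpleGraph.Walk.IsPath.of_adj hadj
    | succ j => exact (hpath j).mapLe hHG
  · intro i
    cases i using Fin.cases with
    | zero => exact Or.inl ⟨ha, hu⟩
    | succ j =>
      have := hend j
      simp only [Finset.mem_erase] at this
      simp only [g, Fin.cons_succ]
      tauto
  · intro i j hij x hx hx'
    cases i using Fin.cases with
    | zero =>
      cases j using Fin.cases with
      | zero => exact hij rfl
      | succ j =>
        have := hnew j x (hsupp j ▸ hx')
        have := hsupp₀ x hx
        tauto
    | succ i =>
      cases j using Fin.cases with
      | zero =>
        have := hnew i x (hsupp i ▸ hx)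
        have := hsupp₀ x hx'
        tauto
      | succ j =>
        exact hvd i j (fun h => hij (h ▸ rfl)) x (hsupp i ▸ hx) (hsupp j ▸ hx')
  · intro z hz
    by_cases hza : z = a
    · exact ⟨0, Or.inl hza⟩
    by_cases hzu : z = u
    · exact ⟨0, Or.inr hzu⟩
    obtain ⟨j, hj⟩ := hcov z (by simpa [hza, hzu] using hz)
    exact ⟨j.succ, hj⟩
  · subst hE
    ext e
    simp [Fin.exists_fin_succ, hedges₀, hedges]

/-- Every edge of a solution is an edge of the graph. -/
theorem IsSolution.subset_edgeSet (h : IsSolution G A B E') : E' ⊆ G.edgeSet := by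
  obtain ⟨k, f, -, -, -, -, -, rfl⟩ := h
  exact Set.iUnion_subset fun i e he => SimpleGraph.Walk.edges_subset_edgeSet _ he

end

/-- Under a bijection of solutions that shifts the length by a constant, the minimum length is
shifted by that constant and the number of minimum-length solutions is preserved. -/
theorem lAB_nSol_of_bijOn {V : Type} [DecidableEq V] {G H : SimpleGraph V} {A B C D : Finset V}
    {ℓ : Sym2 V → ℕ} {F : Set (Sym2 V) → Set (Sym2 V)} {c : ℕ}
    (hbij : Set.BijOn F {E | IsSolution G A B E} {E | IsSolution H C D E})
    (hlen : ∀ E, IsSolution G A B E → lengthOf ℓ (F E) + c = lengthOf ℓ E)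
    (hex : ∃ E, IsSolution G A B E) :
    lAB G A B ℓ = c + lAB H C D ℓ ∧ nSol G A B ℓ = nSol H C D ℓ := by
  obtain ⟨hmaps, hinj, hsurj⟩ := hbij
  have hmin : lAB G A B ℓ = c + lAB H C D ℓ := by
    obtain ⟨E₀, hE₀⟩ := hex
    obtain ⟨E₁, hE₁, h₁⟩ := Nat.sInf_mem
      (s := {n | ∃ E, IsSolution G A B E ∧ lengthOf ℓ E = n}) ⟨_, E₀, hE₀, rfl⟩
    obtain ⟨E₂, hE₂, h₂⟩ := Nat.sInf_mem
      (s := {n | ∃ E, IsSolution H C D E ∧ lengthOf ℓ E = n}) ⟨_, F E₀, hmaps hE₀, rfl⟩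
    obtain ⟨E₃, hE₃, rfl⟩ := hsurj hE₂
    have hle₁ : lAB G A B ℓ ≤ lengthOf ℓ E₃ := Nat.sInf_le ⟨E₃, hE₃, rfl⟩
    have hle₂ : lAB H C D ℓ ≤ lengthOf ℓ (F E₁) := Nat.sInf_le ⟨F E₁, hmaps hE₁, rfl⟩
    have e₁ := hlen E₁ hE₁
    have e₃ := hlen E₃ hE₃
    change lengthOf ℓ E₁ = lAB G A B ℓ at h₁
    change lengthOf ℓ (F E₃) = lAB H C D ℓ at h₂
    omega
  refine ⟨hmin, Set.ncard_congr (fun E _ => F E) ?_ ?_ ?_⟩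
  · rintro E ⟨hE, hl⟩
    have := hlen E hE
    exact ⟨hmaps hE, by omega⟩
  · exact fun E E' hE hE' h => hinj hE.1 hE'.1 h
  · rintro E ⟨hE, hl⟩
    obtain ⟨E', hE', rfl⟩ := hsurj hE
    have := hlen E' hE'
    exact ⟨E', ⟨hE', by omega⟩, rfl⟩

/-!
STATEMENT 14.  Suppose `a ∈ A` has degree 1 in `G` and its unique neighbor `u` also
belongs to `A`.  Every solution to Disjoint `A`,`B`-paths on `G` contains the
single-edge path `au` as one of its paths, and `E′ ↦ E′ ∖ {au}` is a bijection
between solutions on `G` and solutions of Disjoint `A∖{a,u}`,`B`-paths on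
`G − {a,u}` decreasing the length by exactly `ℓ(au)`; in particular a solution on `G`
exists iff one on `G − {a,u}` exists, and then
`ℓ_{A,B}(G) = ℓ(au) + ℓ_{A∖{a,u},B}(G−{a,u})` and the numbers of minimum-length
solutions coincide.
-/
theorem stmt14 {V : Type} [Fintype V] [DecidableEq V]
    (G : SimpleGraph V) (A B : Finset V) (ℓ : Sym2 V → ℕ)
    (hdisj : Disjoint A B) (hA : Even A.card) (hB : Even B.card)
    (hℓ : ∀ e ∈ G.edgeSet, 1 ≤ ℓ e)
    (a u : V) (ha : a ∈ A) (hnb : G.neighborSet a = {u}) (hu : u ∈ A)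
    (G'' : SimpleGraph V)
    (hG'' : G'' = SimpleGraph.fromRel (fun x y =>
      G.Adj x y ∧ x ∉ ({a, u} : Set V) ∧ y ∉ ({a, u} : Set V)))
    (A'' : Finset V) (hA'' : A'' = (A.erase a).erase u) :
    (∀ (E' : Set (Sym2 V)) (k : ℕ) (f : Fin k → (x : V) × (y : V) × G.Walk x y),
      IsPathFamily G A B E' f →
      ∃ i, (((f i).1 = a ∧ (f i).2.1 = u) ∨ ((f i).1 = u ∧ (f i).2.1 = a)) ∧
        {e | e ∈ (f i).2.2.edges} = {s(a, u)}) ∧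
    Set.BijOn (fun E' => E' \ {s(a, u)})
      {E' | IsSolution G A B E'} {E'' | IsSolution G'' A'' B E''} ∧
    (∀ E', IsSolution G A B E' →
      lengthOf ℓ (E' \ {s(a, u)}) + ℓ s(a, u) = lengthOf ℓ E') ∧
    ((∃ E', IsSolution G A B E') ↔ ∃ E'', IsSolution G'' A'' B E'') ∧
    ((∃ E', IsSolution G A B E') →
      lAB G A B ℓ = ℓ s(a, u) + lAB G'' A'' B ℓ ∧
      nSol G A B ℓ = nSol G'' A'' B ℓ) := by
  have hnb' : ∀ v, G.Adj a v → v = u := fun v hv => by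
    have : v ∈ G.neighborSet a := hv
    rwa [hnb] at this
  have hadj : G.Adj a u := by
    have : u ∈ G.neighborSet a := by rw [hnb]; rfl
    exact this
  have hH : ∀ x y, G''.Adj x y ↔ G.Adj x y ∧ x ≠ a ∧ x ≠ u ∧ y ≠ a ∧ y ≠ u := by
    intro x y
    have := G.adj_comm x y
    have hne : G.Adj x y → x ≠ y := SimpleGraph.Adj.ne
    simp only [hG'', SimpleGraph.fromRel_adj, Set.mem_insert_iff, Set.mem_singleton_iff]
    tauto
  subst hA''
  have hleaf : ∀ (E' : Set (Sym2 V)) (k : ℕ) (f : Fin k → (x : V) × (y : V) × G.Walk x y),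
      IsPathFamily G A B E' f →
      ∃ i, (((f i).1 = a ∧ (f i).2.1 = u) ∨ ((f i).1 = u ∧ (f i).2.1 = a)) ∧
        {e | e ∈ (f i).2.2.edges} = {s(a, u)} := fun E' k f hf =>
    hf.exists_leaf_path hdisj hA hB ha hu hadj.ne hnb'
  have hmem : ∀ E', IsSolution G A B E' → s(a, u) ∈ E' := by
    rintro E' ⟨k, f, hf⟩
    obtain ⟨i, -, hi⟩ := hleaf E' k f hf
    rw [hf.2.2.2.2.2]
    exact Set.mem_iUnion.2 ⟨i, hi.symm.subset rfl⟩
  have hbij : Set.BijOn (fun E' => E' \ {s(a, u)})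
      {E' | IsSolution G A B E'} {E'' | IsSolution G'' ((A.erase a).erase u) B E''} := by
    refine ⟨?_, ?_, ?_⟩
    · rintro E' ⟨k, f, hf⟩
      obtain ⟨i, hi, he⟩ := hleaf E' k f hf
      exact hf.isSolution_diff ha hu hadj.ne hdisj
        (fun x y h h₁ h₂ h₃ h₄ => (hH x y).2 ⟨h, h₁, h₂, h₃, h₄⟩) i hi he
    · intro E₁ h₁ E₂ h₂ h
      have := congrArg (insert s(a, u)) h
      simpa [Set.insert_eq_of_mem (hmem _ h₁), Set.insert_eq_of_mem (hmem _ h₂)] using this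
    · intro E'' hE''
      refine ⟨insert s(a, u) E'', IsSolution.insert_edge ha hu hadj
        (fun x y h => ((hH x y).1 h).1) (fun v h => ((hH a v).1 h).2.1 rfl)
        (fun v h => ((hH u v).1 h).2.2.1 rfl) hdisj hE'', ?_⟩
      refine Set.insert_sdiff_self_of_notMem fun h => ?_
      exact ((hH a u).1 (hE''.subset_edgeSet h)).2.1 rfl
  have hlen : ∀ E', IsSolution G A B E' →
      lengthOf ℓ (E' \ {s(a, u)}) + ℓ s(a, u) = lengthOf ℓ E' := by
    intro E' hE'
    have h := finsum_mem_insert ℓ (a := s(a, u)) (s := E' \ {s(a, u)}) (by simp) (Set.toFinite _)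
    rw [Set.insert_sdiff_singleton, Set.insert_eq_of_mem (hmem E' hE')] at h
    rw [lengthOf, lengthOf, h, add_comm]
  refine ⟨hleaf, hbij, hlen, ⟨?_, ?_⟩, lAB_nSol_of_bijOn hbij hlen⟩
  · rintro ⟨E', hE'⟩
    exact ⟨_, hbij.mapsTo hE'⟩
  · rintro ⟨E'', hE''⟩
    obtain ⟨E', hE', -⟩ := hbij.surjOn hE''
    exact ⟨E', hE'⟩
end

section
/- Suppose v ∉ A ∪ B has degree 2 in G, with two distinct neighbors x and y that are not adjacent in G. Let G′ be obtained from G by deleting v and adding the edge xy with length ℓ(xv) + ℓ(vy), all other lengths unchanged. Then there is a length-preserving bijection between solutions of Disjoint A,B-paths on G and on G′, under which a solution of G contains both edges xv and vy if and only if the corresponding solution of G′ contains xy (and the solutions agree on all other edges). In particular, ℓ_{A,B}(G) = ℓ_{A,B}(G′) and S_{A,B}(G) = S_{A,B}(G′), with a solution on G existing if and only if one exists on G′. -/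
/-- `G'` arises from `G` by suppressing the vertex `v` of degree 2, whose neighbours `x` and `y`
are distinct and not adjacent: `v` is isolated in `G'` and the edge `xy` is added. -/
structure IsSuppression {V : Type} (G G' : SimpleGraph V) (v x y : V) : Prop where
  ne : x ≠ y
  not_adj : ¬ G.Adj x y
  adj_iff : ∀ z, G.Adj v z ↔ z = x ∨ z = y
  adj'_iff : ∀ p q, G'.Adj p q ↔ (G.Adj p q ∧ p ≠ v ∧ q ≠ v) ∨ s(p, q) = s(x, y)

/-- Replace the edges `xv`, `vy` by `xy` in an edge set using `v`. -/
def contractEdges {V : Type} (v x y : V) (E : Set (Sym2 V)) : Set (Sym2 V) :=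
  {e | (e ∈ E ∧ v ∉ e) ∨ (e = s(x, y) ∧ s(x, v) ∈ E)}

/-- Replace the edge `xy` by `xv`, `vy` in an edge set. -/
def expandEdges {V : Type} (v x y : V) (E : Set (Sym2 V)) : Set (Sym2 V) :=
  {e | (e ∈ E ∧ e ≠ s(x, y)) ∨ (s(x, y) ∈ E ∧ (e = s(x, v) ∨ e = s(v, y)))}

namespace IsSuppression

variable {V : Type} {G G' : SimpleGraph V} {v x y : V}

theorem ne_left (h : IsSuppression G G' v x y) : x ≠ v :=
  (G.ne_of_adj ((h.adj_iff x).2 (Or.inl rfl))).symm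

theorem ne_right (h : IsSuppression G G' v x y) : y ≠ v :=
  (G.ne_of_adj ((h.adj_iff y).2 (Or.inr rfl))).symm

theorem not_mem_edge (h : IsSuppression G G' v x y) {e : Sym2 V} (he : e ∈ G'.edgeSet) :
    v ∉ e := by
  induction e with | _ p q =>
  have h1 := h.ne_left
  have h2 := h.ne_right
  rw [SimpleGraph.mem_edgeSet, h.adj'_iff] at he
  rcases he with ⟨-, hp, hq⟩ | he
  · simp [hp.symm, hq.symm]
  · simp [he, h1.symm, h2.symm]

theorem not_mem_support (h : IsSuppression G G' v x y) {a b : V} (q : G'.Walk a b)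
    (ha : a ≠ v) : v ∉ q.support := by
  induction q with
  | nil => simpa using ha.symm
  | cons hac q ih =>
    have hv := h.not_mem_edge ((SimpleGraph.mem_edgeSet G').2 hac)
    simp only [Sym2.mem_iff, not_or] at hv
    simpa [hv.1] using ih (Ne.symm hv.2)

theorem eq_of_mem_edge (h : IsSuppression G G' v x y) {e : Sym2 V} (he : e ∈ G.edgeSet)
    (hv : v ∈ e) : e = s(x, v) ∨ e = s(v, y) := by
  obtain ⟨z, rfl⟩ := hv
  rw [SimpleGraph.mem_edgeSet, h.adj_iff] at he
  rcases he with rfl | rfl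
  · exact Or.inl Sym2.eq_swap
  · exact Or.inr rfl

/-- Shortcut a path of `G` across `v`. -/
theorem exists_contract_path (h : IsSuppression G G' v x y) {a b : V} (p : G.Walk a b)
    (hp : p.IsPath) (ha : a ≠ v) (hb : b ≠ v) : ∃ q : G'.Walk a b, q.IsPath ∧
      (∀ z, z ∈ q.support → z ∈ p.support) ∧
      (∀ e, e ∈ q.edges ↔ (e ∈ p.edges ∧ v ∉ e) ∨ (e = s(x, y) ∧ s(x, v) ∈ p.edges)) ∧
      (s(x, v) ∈ p.edges ↔ s(v, y) ∈ p.edges) := by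
  induction hn : p.length using Nat.strong_induction_on generalizing a with | _ n ih =>
  cases p with
  | nil => exact ⟨.nil, by simp⟩
  | @cons _ c _ hac p =>
    rw [SimpleGraph.Walk.cons_isPath_iff] at hp
    by_cases hc : v = c
    · subst hc
      cases p with
      | nil => exact absurd rfl hb
      | @cons _ d _ hcd p =>
        have hcp := hp.1
        rw [SimpleGraph.Walk.cons_isPath_iff] at hcp
        have had : a ∉ p.support := fun hm => hp.2 (by simp [hm])
        have hadne : a ≠ d := fun hm => had (hm ▸ p.start_mem_support)
        obtain ⟨q, hq, hs, he, hxy⟩ := ih p.length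
          (by rw [← hn, SimpleGraph.Walk.length_cons, SimpleGraph.Walk.length_cons]; lia)
          p hcp.1 hcd.ne' rfl
        have hnot : ∀ z, s(z, v) ∉ p.edges := fun z hz =>
          hcp.2 (p.snd_mem_support_of_mem_edges hz)
        have hax := (h.adj_iff a).1 hac.symm
        have hdx := (h.adj_iff d).1 hcd
        have hor : (a = x ∧ d = y) ∨ (a = y ∧ d = x) := by
          rcases hax with h1 | h1 <;> rcases hdx with h2 | h2
          · exact absurd (h1.trans h2.symm) hadne
          · exact Or.inl ⟨h1, h2⟩
          · exact Or.inr ⟨h1, h2⟩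
          · exact absurd (h1.trans h2.symm) hadne
        have hE : s(a, d) = s(x, y) := Sym2.eq_iff.2 hor
        have h1 : s(x, v) ∈ (SimpleGraph.Walk.cons hac (.cons hcd p)).edges := by
          rcases hor with ⟨rfl, rfl⟩ | ⟨rfl, rfl⟩ <;> simp
        have h2 : s(v, y) ∈ (SimpleGraph.Walk.cons hac (.cons hcd p)).edges := by
          rcases hor with ⟨rfl, rfl⟩ | ⟨rfl, rfl⟩ <;> simp
        refine ⟨.cons ((h.adj'_iff a d).2 (Or.inr hE)) q, ?_, ?_, ?_, by simp only [h1, h2]⟩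
        · rw [SimpleGraph.Walk.cons_isPath_iff]
          exact ⟨hq, fun hm => had (hs a hm)⟩
        · intro z hz
          rw [SimpleGraph.Walk.support_cons, List.mem_cons] at hz
          rcases hz with rfl | hz
          · simp
          · simp [hs z hz]
        · intro e
          have h3 := he e
          have h4 := hnot x
          simp only [SimpleGraph.Walk.edges_cons, List.mem_cons, hE]
          have h5 : e = s(a, v) → v ∈ e := by rintro rfl; simp
          have h6 : e = s(v, d) → v ∈ e := by rintro rfl; simp
          grind
    · obtain ⟨q, hq, hs, he, hxy⟩ := ih p.length
        (by rw [← hn, SimpleGraph.Walk.length_cons]; lia) p hp.1 (Ne.symm hc) rfl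
      refine ⟨.cons ((h.adj'_iff a c).2 (Or.inl ⟨hac, ha, Ne.symm hc⟩)) q, ?_, ?_, ?_, ?_⟩
      · rw [SimpleGraph.Walk.cons_isPath_iff]
        exact ⟨hq, fun hm => hp.2 (hs a hm)⟩
      · intro z hz
        rw [SimpleGraph.Walk.support_cons, List.mem_cons] at hz ⊢
        exact hz.imp_right (hs z)
      · intro e
        have h1 : s(x, v) ≠ s(a, c) := by simp [Ne.symm ha, hc]
        have h2 : e = s(a, c) → v ∉ e := by rintro rfl; simp [Ne.symm ha, hc]
        have h3 := he e
        simp only [SimpleGraph.Walk.edges_cons, List.mem_cons]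
        grind
      · have h1 : s(x, v) ≠ s(a, c) := by simp [Ne.symm ha, hc]
        have h2 : s(v, y) ≠ s(a, c) := by simp [Ne.symm ha, hc]
        simp only [SimpleGraph.Walk.edges_cons, List.mem_cons, h1, h2, false_or, hxy]

/-- Route a path of `G'` through `v` instead of using the edge `xy`. -/
theorem exists_expand_path (h : IsSuppression G G' v x y) {a b : V} (q : G'.Walk a b)
    (hq : q.IsPath) (ha : a ≠ v) : ∃ p : G.Walk a b, p.IsPath ∧
      (∀ z, z ∈ p.support → z ∈ q.support ∨ (z = v ∧ s(x, y) ∈ q.edges)) ∧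
      (∀ e, e ∈ p.edges ↔ (e ∈ q.edges ∧ e ≠ s(x, y)) ∨
        (s(x, y) ∈ q.edges ∧ (e = s(x, v) ∨ e = s(v, y)))) := by
  induction q with
  | nil => exact ⟨.nil, by simp⟩
  | @cons a c b hac q ih =>
    rw [SimpleGraph.Walk.cons_isPath_iff] at hq
    have hvac := h.not_mem_edge ((SimpleGraph.mem_edgeSet G').2 hac)
    simp only [Sym2.mem_iff, not_or] at hvac
    obtain ⟨p, hp, hs, he⟩ := ih hq.1 (Ne.symm hvac.2)
    have hnot : s(a, c) ∉ q.edges := fun hm => hq.2 (q.fst_mem_support_of_mem_edges hm)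
    have hap : a ∉ p.support := fun hm => by
      rcases hs a hm with hm | hm
      · exact hq.2 hm
      · exact ha hm.1
    by_cases hE : s(a, c) = s(x, y)
    · rw [hE] at hnot
      have hvq := h.not_mem_support q (Ne.symm hvac.2)
      have hvp : v ∉ p.support := fun hm => by
        rcases hs v hm with hm | hm
        · exact hvq hm
        · exact hnot hm.2
      have hva : G.Adj a v := by
        rw [G.adj_comm, h.adj_iff]
        rcases Sym2.eq_iff.1 hE with ⟨rfl, rfl⟩ | ⟨rfl, rfl⟩ <;> simp
      have hvc : G.Adj v c := by
        rw [h.adj_iff]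
        rcases Sym2.eq_iff.1 hE with ⟨rfl, rfl⟩ | ⟨rfl, rfl⟩ <;> simp
      refine ⟨.cons hva (.cons hvc p), ?_, ?_, ?_⟩
      · simp only [SimpleGraph.Walk.cons_isPath_iff, SimpleGraph.Walk.support_cons,
          List.mem_cons, not_or]
        exact ⟨⟨hp, hvp⟩, ha, hap⟩
      · intro z hz
        have := hs z
        simp only [SimpleGraph.Walk.support_cons, List.mem_cons, SimpleGraph.Walk.edges_cons,
          hE] at hz ⊢
        grind
      · intro e
        have h1 := he e
        have h2 : (e = s(a, v) ∨ e = s(v, c)) ↔ (e = s(x, v) ∨ e = s(v, y)) := by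
          rcases Sym2.eq_iff.1 hE with ⟨rfl, rfl⟩ | ⟨rfl, rfl⟩
          · rfl
          · rw [or_comm, Sym2.eq_swap (a := v), Sym2.eq_swap (a := a)]
        have h3 : e = s(x, y) → e ∉ q.edges := by rintro rfl; exact hnot
        simp only [SimpleGraph.Walk.edges_cons, List.mem_cons, hE]
        grind
    · have hadj : G.Adj a c := by
        rcases (h.adj'_iff a c).1 hac with h1 | h1
        · exact h1.1
        · exact absurd h1 hE
      refine ⟨.cons hadj p, ?_, ?_, ?_⟩
      · rw [SimpleGraph.Walk.cons_isPath_iff]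
        exact ⟨hp, hap⟩
      · intro z hz
        have := hs z
        simp only [SimpleGraph.Walk.support_cons, List.mem_cons, SimpleGraph.Walk.edges_cons]
          at hz ⊢
        grind
      · intro e
        have h1 := he e
        have h2 : e = s(a, c) → e ≠ s(x, y) := by rintro rfl; exact hE
        have h3 := Ne.symm hE
        simp only [SimpleGraph.Walk.edges_cons, List.mem_cons]
        grind

variable [DecidableEq V] {A B : Finset V} {E : Set (Sym2 V)}

theorem contract_isSolution (h : IsSuppression G G' v x y) (hv : v ∉ A ∪ B)
    (hE : IsSolution G A B E) :
    IsSolution G' A B (contractEdges v x y E) ∧ (s(x, v) ∈ E ↔ s(v, y) ∈ E) := by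
  obtain ⟨k, f, hk, hpath, hend, hdis, hcov, rfl⟩ := hE
  have hne : ∀ i, (f i).1 ≠ v ∧ (f i).2.1 ≠ v := fun i => by
    constructor <;> rintro rfl <;> rcases hend i with h | h <;> simp [h] at hv
  choose q hq hs he hxy using fun i =>
    h.exists_contract_path (f i).2.2 (hpath i) (hne i).1 (hne i).2
  refine ⟨⟨k, fun i => ⟨_, _, q i⟩, hk, hq, hend,
    fun i j hij z hi hj => hdis i j hij z (hs i z hi) (hs j z hj), hcov, ?_⟩, by simp [hxy]⟩
  ext e
  simp only [contractEdges, Set.mem_iUnion, Set.mem_ofPred_eq, he, exists_or, exists_and_left,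
    exists_and_right]

theorem expand_isSolution (h : IsSuppression G G' v x y) (hv : v ∉ A ∪ B)
    (hE : IsSolution G' A B E) : IsSolution G A B (expandEdges v x y E) := by
  obtain ⟨k, f, hk, hpath, hend, hdis, hcov, rfl⟩ := hE
  have hne : ∀ i, (f i).1 ≠ v := fun i => by
    rintro rfl; rcases hend i with h | h <;> simp [h] at hv
  have hvs : ∀ i, v ∉ (f i).2.2.support := fun i => h.not_mem_support _ (hne i)
  choose p hp hs he using fun i => h.exists_expand_path (f i).2.2 (hpath i) (hne i)
  refine ⟨k, fun i => ⟨_, _, p i⟩, hk, hp, hend, fun i j hij z hi hj => ?_, hcov, ?_⟩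
  · rcases hs i z hi with hi | ⟨rfl, hi⟩ <;> rcases hs j z hj with hj | ⟨hz, hj⟩
    · exact hdis i j hij z hi hj
    · exact hvs i (hz ▸ hi)
    · exact hvs j hj
    · exact hdis i j hij x (SimpleGraph.Walk.fst_mem_support_of_mem_edges _ hi)
        (SimpleGraph.Walk.fst_mem_support_of_mem_edges _ hj)
  · ext e
    simp only [expandEdges, Set.mem_iUnion, Set.mem_ofPred_eq, he, exists_or, exists_and_right]

end IsSuppression

theorem IsSolution.subset_edgeSet_s15 {V : Type} [DecidableEq V] {G : SimpleGraph V} {A B : Finset V}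
    {E : Set (Sym2 V)} (hE : IsSolution G A B E) : E ⊆ G.edgeSet := by
  obtain ⟨k, f, -, -, -, -, -, rfl⟩ := hE
  exact Set.iUnion_subset fun i e he => (f i).2.2.edges_subset_edgeSet he

namespace IsSuppression

variable {V : Type} {G G' : SimpleGraph V} {v x y : V} {E : Set (Sym2 V)}

theorem mem_contractEdges_iff (h : IsSuppression G G' v x y) (hE : E ⊆ G.edgeSet) :
    s(x, y) ∈ contractEdges v x y E ↔ s(x, v) ∈ E := by
  have h1 : s(x, y) ∉ E := fun hm => h.not_adj (hE hm)
  simp [contractEdges, h1]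

theorem expandEdges_contractEdges (h : IsSuppression G G' v x y) (hE : E ⊆ G.edgeSet)
    (hiff : s(x, v) ∈ E ↔ s(v, y) ∈ E) : expandEdges v x y (contractEdges v x y E) = E := by
  ext e
  have h0 := h.mem_contractEdges_iff hE
  have h1 : e = s(x, y) → e ∉ E := by rintro rfl hm; exact h.not_adj (hE hm)
  have h2 : e ∈ E → v ∈ e → e = s(x, v) ∨ e = s(v, y) := fun hm => h.eq_of_mem_edge (hE hm)
  have h3 : e = s(x, v) → (e ∈ E ↔ s(x, v) ∈ E) := by rintro rfl; rfl
  have h4 : e = s(v, y) → (e ∈ E ↔ s(v, y) ∈ E) := by rintro rfl; rfl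
  rw [expandEdges, Set.mem_ofPred_eq, h0, contractEdges, Set.mem_ofPred_eq]
  tauto

theorem contractEdges_expandEdges (h : IsSuppression G G' v x y) (hE : E ⊆ G'.edgeSet) :
    contractEdges v x y (expandEdges v x y E) = E := by
  ext e
  have h1 : e ∈ E → v ∉ e := fun hm => h.not_mem_edge (hE hm)
  have h2 : s(x, v) ∉ E := fun hm => h.not_mem_edge (hE hm) (by simp)
  have h3 : e = s(x, v) → v ∈ e := by rintro rfl; simp
  have h4 : e = s(v, y) → v ∈ e := by rintro rfl; simp
  have h5 : e = s(x, y) → (e ∈ E ↔ s(x, y) ∈ E) := by rintro rfl; rfl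
  simp only [contractEdges, expandEdges, Set.mem_ofPred_eq, h2, true_or, and_true, false_and,
    false_or]
  tauto

theorem lengthOf_contractEdges [Finite V] (h : IsSuppression G G' v x y) (hE : E ⊆ G.edgeSet)
    (hiff : s(x, v) ∈ E ↔ s(v, y) ∈ E) {ℓ ℓ' : Sym2 V → ℕ}
    (hxy : ℓ' s(x, y) = ℓ s(x, v) + ℓ s(v, y)) (hne : ∀ e, e ≠ s(x, y) → ℓ' e = ℓ e) :
    lengthOf ℓ' (contractEdges v x y E) = lengthOf ℓ E := by
  have hxE : s(x, y) ∉ E := fun hm => h.not_adj (hE hm)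
  have hcongr : ∀ D ⊆ E, ∑ᶠ e ∈ D, ℓ' e = ∑ᶠ e ∈ D, ℓ e := fun D hD =>
    finsum_mem_congr rfl fun e he => hne e fun h' => hxE (h' ▸ hD he)
  have hD : {e | e ∈ E ∧ v ∉ e} ⊆ E := fun e he => he.1
  by_cases hx : s(x, v) ∈ E
  · have h1 : contractEdges v x y E = insert s(x, y) {e | e ∈ E ∧ v ∉ e} := by
      ext e
      simp [contractEdges, hx, or_comm]
    have h2 : E = insert s(x, v) (insert s(v, y) {e | e ∈ E ∧ v ∉ e}) := by
      ext e
      have h2 : e ∈ E → v ∈ e → e = s(x, v) ∨ e = s(v, y) := fun hm => h.eq_of_mem_edge (hE hm)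
      have h3 : e = s(x, v) → e ∈ E := by rintro rfl; exact hx
      have h4 : e = s(v, y) → e ∈ E := by rintro rfl; exact hiff.1 hx
      simp only [Set.mem_insert_iff, Set.mem_ofPred_eq]
      tauto
    have h3 := h.ne
    have h4 := h.ne_left
    rw [lengthOf, lengthOf, h1, finsum_mem_insert _ (fun hm => hxE hm.1) (Set.toFinite _),
      hcongr _ hD, hxy]
    conv_rhs => rw [h2]
    rw [finsum_mem_insert _ (by simp [h3, h4]) (Set.toFinite _),
      finsum_mem_insert _ (by simp) (Set.toFinite _), add_assoc]
  · have h1 : contractEdges v x y E = E := by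
      ext e
      have h2 : e ∈ E → v ∈ e → e = s(x, v) ∨ e = s(v, y) := fun hm => h.eq_of_mem_edge (hE hm)
      have h3 : e = s(x, v) → e ∉ E := by rintro rfl; exact hx
      have h4 : e = s(v, y) → e ∉ E := by rintro rfl; exact fun hm => hx (hiff.2 hm)
      simp only [contractEdges, Set.mem_ofPred_eq]
      tauto
    rw [lengthOf, lengthOf, h1, hcongr E subset_rfl]

end IsSuppression

/-!
STATEMENT 15.  Suppose `v ∉ A ∪ B` has degree 2 in `G`, with distinct neighbors `x`
and `y` that are not adjacent in `G`.  Let `G′` be obtained from `G` by deleting `v`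
and adding the edge `xy` with length `ℓ(xv) + ℓ(vy)`.  Then there is a
length-preserving bijection between solutions on `G` and on `G′` under which a
solution of `G` contains both `xv` and `vy` iff the corresponding solution of `G′`
contains `xy` (and they agree on all other edges).  In particular
`ℓ_{A,B}(G) = ℓ_{A,B}(G′)` and `S_{A,B}(G) = S_{A,B}(G′)`, with a solution on `G`
existing iff one exists on `G′`.
-/
theorem stmt15 {V : Type} [Fintype V] [DecidableEq V]
    (G : SimpleGraph V) (A B : Finset V) (ℓ : Sym2 V → ℕ)
    (hdisj : Disjoint A B) (hA : Even A.card) (hB : Even B.card)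
    (hℓ : ∀ e ∈ G.edgeSet, 1 ≤ ℓ e)
    (v x y : V) (hv : v ∉ A ∪ B) (hnb : G.neighborSet v = {x, y}) (hxy : x ≠ y)
    (hnadj : ¬ G.Adj x y)
    (G' : SimpleGraph V)
    (hG' : G' = SimpleGraph.fromRel (fun p q =>
      (G.Adj p q ∧ p ≠ v ∧ q ≠ v) ∨ (p = x ∧ q = y)))
    (ℓ' : Sym2 V → ℕ)
    (hℓ' : ℓ' = fun e => if e = s(x, y) then ℓ s(x, v) + ℓ s(v, y) else ℓ e) :
    ∃ φ : Set (Sym2 V) → Set (Sym2 V),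
      Set.BijOn φ {E' | IsSolution G A B E'} {E'' | IsSolution G' A B E''} ∧
      (∀ E', IsSolution G A B E' →
        lengthOf ℓ' (φ E') = lengthOf ℓ E' ∧
        ((s(x, v) ∈ E' ∧ s(v, y) ∈ E') ↔ s(x, y) ∈ φ E') ∧
        (∀ e : Sym2 V, e ≠ s(x, v) → e ≠ s(v, y) → e ≠ s(x, y) →
          (e ∈ E' ↔ e ∈ φ E'))) ∧
      lAB G A B ℓ = lAB G' A B ℓ' ∧
      nSol G A B ℓ = nSol G' A B ℓ' ∧
      ((∃ E', IsSolution G A B E') ↔ ∃ E'', IsSolution G' A B E'') := by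
  have hadj : ∀ z, G.Adj v z ↔ z = x ∨ z = y := fun z => by
    rw [← SimpleGraph.mem_neighborSet, hnb]; simp
  have h : IsSuppression G G' v x y := by
    refine ⟨hxy, hnadj, hadj, fun p q => ?_⟩
    have h1 : G.Adj p q → p ≠ q := SimpleGraph.Adj.ne
    have h2 := G.adj_comm p q
    have h3 : p = x → q = y → p ≠ q := by rintro rfl rfl; exact hxy
    have h4 : p = y → q = x → p ≠ q := by rintro rfl rfl; exact hxy.symm
    rw [hG', SimpleGraph.fromRel_adj, Sym2.eq_iff]
    clear hG' hℓ' hℓ hdisj hA hB hv hnb hadj hnadj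
    grind
  have hiff : ∀ E', IsSolution G A B E' → (s(x, v) ∈ E' ↔ s(v, y) ∈ E') :=
    fun E' hE' => (h.contract_isSolution hv hE').2
  have hbij : Set.BijOn (contractEdges v x y) {E' | IsSolution G A B E'}
      {E'' | IsSolution G' A B E''} :=
    Set.InvOn.bijOn (f' := expandEdges v x y)
      ⟨fun E' hE' => h.expandEdges_contractEdges hE'.subset_edgeSet_s15 (hiff E' hE'),
        fun E' hE' => h.contractEdges_expandEdges hE'.subset_edgeSet_s15⟩
      (fun E' hE' => (h.contract_isSolution hv hE').1)
      (fun E' hE' => h.expand_isSolution hv hE')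
  have hlen : ∀ E', IsSolution G A B E' →
      lengthOf ℓ' (contractEdges v x y E') = lengthOf ℓ E' := fun E' hE' =>
    h.lengthOf_contractEdges hE'.subset_edgeSet_s15 (hiff E' hE') (by simp [hℓ'])
      (fun e he => by simp [hℓ', he])
  have hmin : lAB G A B ℓ = lAB G' A B ℓ' := by
    unfold lAB
    congr 1
    ext n
    constructor
    · rintro ⟨E', hE', rfl⟩
      exact ⟨_, hbij.mapsTo hE', hlen E' hE'⟩
    · rintro ⟨E'', hE'', rfl⟩
      obtain ⟨E', hE', rfl⟩ := hbij.surjOn hE''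
      exact ⟨E', hE', (hlen E' hE').symm⟩
  refine ⟨contractEdges v x y, hbij, fun E' hE' => ⟨hlen E' hE', ?_, ?_⟩, hmin, ?_, ?_⟩
  · rw [h.mem_contractEdges_iff hE'.subset_edgeSet_s15, ← hiff E' hE', and_self]
  · intro e h1 h2 h3
    have h4 : e ∈ E' → v ∈ e → e = s(x, v) ∨ e = s(v, y) := fun hm =>
      h.eq_of_mem_edge (hE'.subset_edgeSet_s15 hm)
    simp only [contractEdges, Set.mem_ofPred_eq]
    tauto
  · unfold nSol
    rw [← hmin, ← (hbij.injOn.mono fun E' hE' => hE'.1).ncard_image]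
    congr 1
    ext E''
    constructor
    · rintro ⟨E', ⟨hE', hl⟩, rfl⟩
      exact ⟨hbij.mapsTo hE', (hlen E' hE').trans hl⟩
    · rintro ⟨hE'', hl⟩
      obtain ⟨E', hE', rfl⟩ := hbij.surjOn hE''
      exact ⟨E', ⟨hE', (hlen E' hE').symm.trans hl⟩, rfl⟩
  · constructor
    · rintro ⟨E', hE'⟩
      exact ⟨_, hbij.mapsTo hE'⟩
    · rintro ⟨E'', hE''⟩
      exact ⟨_, h.expand_isSolution hv hE''⟩
end

section
/- Suppose G contains a simple path P = (x₀, x₁, …, x_k) all of whose internal vertices x₁,…,x_{k−1} have degree 2 in G, and suppose there are indices 0 < i < j < r < k with x_i ∈ A, x_j ∈ B, x_r ∈ A, such that no vertex x_t with i < t < r and t ≠ j belongs to A ∪ B. Then no solution to Disjoint A,B-paths on G exists. -/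
/-- A walk starting in `S` ends in `S`, provided no edge leads from `S` to a vertex of the walk
outside `S`. -/
theorem SimpleGraph.Walk.end_mem_of_closed {V : Type*} {G : SimpleGraph V} {S : Set V}
    {u v : V} (w : G.Walk u v) (hu : u ∈ S)
    (h : ∀ y ∈ S, ∀ z, G.Adj y z → z ∈ w.support → z ∈ S) : v ∈ S := by
  induction w with
  | nil => exact hu
  | cons hadj p ih =>
    refine ih (h _ hu _ hadj (by simp)) fun y hy z hyz hz => h y hy z hyz ?_
    simp [hz]

/-- A vertex with exactly two neighbours is adjacent to nothing else. -/
theorem SimpleGraph.eq_or_eq_of_ncard_neighborSet_eq_two {V : Type*} {G : SimpleGraph V}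
    {a b c z : V} (hdeg : (G.neighborSet b).ncard = 2) (ha : G.Adj b a) (hc : G.Adj b c)
    (hac : a ≠ c) (hz : G.Adj b z) : z = a ∨ z = c := by
  have hsub : ({a, c} : Set V) ⊆ G.neighborSet b := by
    rintro y (rfl | rfl) <;> assumption
  have heq := Set.eq_of_subset_of_ncard_le hsub (by rw [hdeg, Set.ncard_pair hac])
    (Set.finite_of_ncard_ne_zero (by omega))
  have hmem : z ∈ ({a, c} : Set V) := heq ▸ hz
  simpa using hmem

/-- The paths of a path family have distinct endpoints. -/
theorem IsPathFamily.endpoints_ne {V : Type} [DecidableEq V] {G : SimpleGraph V}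
    {A B : Finset V} {E' : Set (Sym2 V)} {k : ℕ} {f : Fin k → (u : V) × (v : V) × G.Walk u v}
    (hf : IsPathFamily G A B E' f) (hdisj : Disjoint A B) (hA : Even A.card)
    (hB : Even B.card) (m : Fin k) : (f m).1 ≠ (f m).2.1 := by
  obtain ⟨hk, -, -, -, hcover, -⟩ := hf
  let g : Fin k × Bool → V := fun p => if p.2 then (f p.1).1 else (f p.1).2.1
  have hsub : A ∪ B ⊆ Finset.univ.image g := by
    intro z hz
    obtain ⟨n, rfl | rfl⟩ := hcover z hz
    · exact Finset.mem_image.2 ⟨(n, true), by simp [g]⟩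
    · exact Finset.mem_image.2 ⟨(n, false), by simp [g]⟩
  have hcard := Finset.card_le_card hsub
  rw [Finset.card_union_of_disjoint hdisj] at hcard
  have huniv : (Finset.univ : Finset (Fin k × Bool)).card = A.card + B.card := by
    obtain ⟨a, ha⟩ := hA
    obtain ⟨b, hb⟩ := hB
    simp only [Finset.card_univ, Fintype.card_prod, Fintype.card_fin, Fintype.card_bool]
    omega
  have hinj : Set.InjOn g (Finset.univ : Finset (Fin k × Bool)) :=
    Finset.card_image_iff.1 (le_antisymm Finset.card_image_le (huniv ▸ hcard))
  intro heq
  have hpair : (m, true) = (m, false) := hinj (by simp) (by simp) (by simpa [g] using heq)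
  simp at hpair

/-!
STATEMENT 16.  Suppose `G` contains a simple path `P = (x₀, x₁, …, x_k)` all of whose
internal vertices have degree 2 in `G`, and there are indices `0 < i < j < r < k`
with `x_i ∈ A`, `x_j ∈ B`, `x_r ∈ A`, such that no vertex `x_t` with `i < t < r`,
`t ≠ j`, belongs to `A ∪ B`.  Then no solution to Disjoint `A`,`B`-paths exists.
-/
theorem stmt16 {V : Type} [Fintype V] [DecidableEq V]
    (G : SimpleGraph V) (A B : Finset V) (ℓ : Sym2 V → ℕ)
    (hdisj : Disjoint A B) (hA : Even A.card) (hB : Even B.card)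
    (hℓ : ∀ e ∈ G.edgeSet, 1 ≤ ℓ e)
    (k : ℕ) (x : ℕ → V)
    (hadj : ∀ t, t < k → G.Adj (x t) (x (t + 1)))
    (hinj : ∀ s₁ t₁, s₁ ≤ k → t₁ ≤ k → x s₁ = x t₁ → s₁ = t₁)
    (hdeg : ∀ t, 0 < t → t < k → (G.neighborSet (x t)).ncard = 2)
    (i j r : ℕ) (h0i : 0 < i) (hij : i < j) (hjr : j < r) (hrk : r < k)
    (hiA : x i ∈ A) (hjB : x j ∈ B) (hrA : x r ∈ A)
    (hgap : ∀ t, i < t → t < r → t ≠ j → x t ∉ A ∪ B) :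
    ¬ ∃ E', IsSolution G A B E' := by
  rintro ⟨E', n, f, hf⟩
  have hne := hf.endpoints_ne hdisj hA hB
  obtain ⟨-, -, hends, hdj, hcover, -⟩ := hf
  obtain ⟨m, hm⟩ := hcover (x j) (Finset.mem_union_right _ hjB)
  have hnotA : ∀ {z}, z ∈ B → z ∉ A := fun hzB hzA => Finset.disjoint_left.1 hdisj hzA hzB
  have hmB : (f m).1 ∈ B ∧ (f m).2.1 ∈ B := by
    rcases hends m with h | h
    · rcases hm with hm | hm
      · exact absurd (hm ▸ h.1) (hnotA hjB)
      · exact absurd (hm ▸ h.2) (hnotA hjB)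
    · exact h
  have havoid : ∀ z ∈ A, z ∉ (f m).2.2.support := by
    intro z hzA hz
    obtain ⟨m', hm'⟩ := hcover z (Finset.mem_union_left _ hzA)
    by_cases hmm : m = m'
    · subst hmm
      rcases hm' with h | h
      · exact hnotA hmB.1 (h ▸ hzA)
      · exact hnotA hmB.2 (h ▸ hzA)
    · refine hdj m m' hmm z hz ?_
      rcases hm' with h | h
      · rw [h]; exact (f m').2.2.start_mem_support
      · rw [h]; exact (f m').2.2.end_mem_support
  let S : Set V := {z | ∃ t, i < t ∧ t < r ∧ x t = z}
  have hclosed : ∀ y ∈ S, ∀ z, G.Adj y z → z ∈ (f m).2.2.support → z ∈ S := by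
    rintro _ ⟨t, hit, htr, rfl⟩ z hz hsupp
    have hprev : G.Adj (x t) (x (t - 1)) := by
      have h := hadj (t - 1) (by omega)
      rw [Nat.sub_add_cancel (by omega)] at h
      exact h.symm
    have hprev_ne : x (t - 1) ≠ x (t + 1) := fun h => by
      have := hinj _ _ (by omega) (by omega) h
      omega
    rcases SimpleGraph.eq_or_eq_of_ncard_neighborSet_eq_two (hdeg t (by omega) (by omega))
      hprev (hadj t (by omega)) hprev_ne hz with rfl | rfl
    · have hti : t - 1 ≠ i := fun h => havoid _ hiA (h ▸ hsupp)
      exact ⟨t - 1, by omega, by omega, rfl⟩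
    · have htr' : t + 1 ≠ r := fun h => havoid _ hrA (h ▸ hsupp)
      exact ⟨t + 1, by omega, by omega, rfl⟩
  have hunique : ∀ z ∈ S, z ∈ B → z = x j := by
    rintro _ ⟨t, hit, htr, rfl⟩ hzB
    by_contra hzj
    exact hgap t hit htr (fun h => hzj (h ▸ rfl)) (Finset.mem_union_right _ hzB)
  have hjS : x j ∈ S := ⟨j, hij, hjr, rfl⟩
  rcases hm with hm | hm
  · have hend := (f m).2.2.end_mem_of_closed (hm ▸ hjS) hclosed
    exact hne m (hm.symm.trans (hunique _ hend hmB.2).symm)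
  · have hstart := (f m).2.2.reverse.end_mem_of_closed (hm ▸ hjS)
      (by simpa only [SimpleGraph.Walk.support_reverse, List.mem_reverse] using hclosed)
    exact hne m ((hunique _ hstart hmB.1).trans hm)
end
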